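/- arXiv:2510.26153 — 2 statements merged into one kernel-verified Lean document; each statement's English description precedes it below -/
import Mathlib

section
/- (Viscous shock profile: existence, Lemma 2.2, existence part) There exists a continuously differentiable function φ : ℝ → ℝ such that φ'(ξ) = f₀(φ(ξ)) for every ξ ∈ ℝ, u₊ < φ(ξ) < u₋ for every ξ, φ is strictly decreasing, φ(ξ) → u₋ as ξ → -∞ and φ(ξ) → u₊ as ξ → +∞. Moreover φ is unique up to translation: any continuously differentiable ψ : ℝ → ℝ with ψ' = f₀ ∘ ψ, ψ(ξ) → u₋ as ξ → -∞ and ψ(ξ) → u₊ as ξ → +∞ satisfies ψ(ξ) = φ(ξ - c) for some constant c and all ξ. -/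
open Set Filter Topology in
theorem vsp_G (g : ℝ → ℝ) (a b : ℝ) (hab : a < b) (hg : ContDiff ℝ 1 g)
    (ha : g a = 0) (hb : g b = 0) (hneg : ∀ x ∈ Ioo a b, g x < 0) :
    ∃ G : ℝ → ℝ, (∀ x ∈ Ioo a b, HasDerivAt G (g x)⁻¹ x) ∧
      (∀ y : ℝ, ∃ x ∈ Ioo a b, G x < y) ∧ (∀ y : ℝ, ∃ x ∈ Ioo a b, y < G x) := by
  obtain ⟨K, hK⟩ := (hg.contDiffOn (s := Icc a b)).exists_lipschitzOnWith (by decide)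
    (convex_Icc _ _) isCompact_Icc
  obtain ⟨L, hL, hKL⟩ : ∃ L : ℝ, 0 < L ∧ (K : ℝ) ≤ L :=
    ⟨K + 1, by positivity, by linarith⟩
  have hLb : ∀ x ∈ Ioo a b, -g x ≤ L * (b - x) := by
    intro x hx
    have h := hK.dist_le_mul x (Ioo_subset_Icc_self hx) b (right_mem_Icc.2 hab.le)
    rw [Real.dist_eq, Real.dist_eq, hb, abs_of_nonpos (by linarith [hneg x hx]),
      abs_of_nonpos (by linarith [hx.2])] at h
    have := mul_le_mul_of_nonneg_right hKL (sub_nonneg.2 hx.2.le)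
    linarith
  have hLa : ∀ x ∈ Ioo a b, -g x ≤ L * (x - a) := by
    intro x hx
    have h := hK.dist_le_mul x (Ioo_subset_Icc_self hx) a (left_mem_Icc.2 hab.le)
    rw [Real.dist_eq, Real.dist_eq, ha, abs_of_nonpos (by linarith [hneg x hx]),
      abs_of_nonneg (by linarith [hx.1])] at h
    have := mul_le_mul_of_nonneg_right hKL (sub_nonneg.2 hx.1.le)
    linarith
  have hinv : ∀ p q : ℝ, p < 0 → 0 < q → -p ≤ L * q → p⁻¹ + L⁻¹ * q⁻¹ ≤ 0 := by
    intro p q hp hq h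
    have h1 : (L * q)⁻¹ ≤ (-p)⁻¹ := inv_anti₀ (by linarith) h
    rw [mul_inv, inv_neg] at h1
    linarith
  have hcont : ContinuousOn (fun x => (g x)⁻¹) (Ioo a b) :=
    hg.continuous.continuousOn.inv₀ fun x hx => (hneg x hx).ne
  obtain ⟨m, hm⟩ : ∃ m, m ∈ Ioo a b := nonempty_Ioo.2 hab
  have hG : ∀ x ∈ Ioo a b, HasDerivAt (fun u => ∫ t in m..u, (g t)⁻¹) (g x)⁻¹ x := by
    intro x hx
    apply intervalIntegral.integral_hasDerivAt_right
    · apply ContinuousOn.intervalIntegrable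
      exact hcont.mono ((ordConnected_Ioo).uIcc_subset hm hx)
    · exact hcont.stronglyMeasurableAtFilter isOpen_Ioo x hx
    · exact hcont.continuousAt (isOpen_Ioo.mem_nhds hx)
  refine ⟨fun u => ∫ t in m..u, (g t)⁻¹, hG, ?_, ?_⟩
  · set G := fun u => ∫ t in m..u, (g t)⁻¹ with hGdef
    have hGm : G m = 0 := by simp [hGdef]
    have hd : ∀ x ∈ Ioo a b, HasDerivAt (fun u => G u - L⁻¹ * Real.log (b - u))
        ((g x)⁻¹ + L⁻¹ * (b - x)⁻¹) x := by
      intro x hx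
      have h1 := (((hasDerivAt_id x).const_sub b).log
        (by simp only [id]; linarith [hx.2])).const_mul L⁻¹
      refine ((hG x hx).sub h1).congr_deriv ?_
      simp only [id]
      ring
    have hanti : AntitoneOn (fun u => G u - L⁻¹ * Real.log (b - u)) (Ioo a b) := by
      apply antitoneOn_of_deriv_nonpos (convex_Ioo a b)
      · exact fun x hx => (hd x hx).continuousAt.continuousWithinAt
      · rw [interior_Ioo]
        exact fun x hx => (hd x hx).differentiableAt.differentiableWithinAt
      · rw [interior_Ioo]
        intro x hx
        rw [(hd x hx).deriv]
        exact hinv _ _ (hneg x hx) (by linarith [hx.2]) (hLb x hx)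
    intro y
    set N := L * (|y| + 1) with hN
    have hNpos : 0 < N := by positivity
    have he : Real.exp (-N) < 1 := by simpa using hNpos
    have he0 := Real.exp_pos (-N)
    have hbm : 0 < b - m := by linarith [hm.2]
    have hmx : m ≤ b - (b - m) * Real.exp (-N) := by nlinarith
    have hx : b - (b - m) * Real.exp (-N) ∈ Ioo a b :=
      ⟨by linarith [hm.1], by nlinarith⟩
    refine ⟨_, hx, ?_⟩
    have h := hanti hm hx hmx
    simp only [hGm, sub_sub_cancel] at h
    rw [Real.log_mul hbm.ne' he0.ne', Real.log_exp] at h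
    have h2 : L⁻¹ * N = |y| + 1 := by rw [hN]; field_simp
    have h3 : L⁻¹ * (Real.log (b - m) + -N) = L⁻¹ * Real.log (b - m) - (|y| + 1) := by
      rw [← h2]; ring
    rw [h3] at h
    linarith [neg_abs_le y]
  · set G := fun u => ∫ t in m..u, (g t)⁻¹ with hGdef
    have hGm : G m = 0 := by simp [hGdef]
    have hd : ∀ x ∈ Ioo a b, HasDerivAt (fun u => G u + L⁻¹ * Real.log (u - a))
        ((g x)⁻¹ + L⁻¹ * (x - a)⁻¹) x := by
      intro x hx
      have h1 := (((hasDerivAt_id x).sub_const a).log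
        (by simp only [id]; linarith [hx.1])).const_mul L⁻¹
      refine ((hG x hx).add h1).congr_deriv ?_
      simp only [id]
      ring
    have hanti : AntitoneOn (fun u => G u + L⁻¹ * Real.log (u - a)) (Ioo a b) := by
      apply antitoneOn_of_deriv_nonpos (convex_Ioo a b)
      · exact fun x hx => (hd x hx).continuousAt.continuousWithinAt
      · rw [interior_Ioo]
        exact fun x hx => (hd x hx).differentiableAt.differentiableWithinAt
      · rw [interior_Ioo]
        intro x hx
        rw [(hd x hx).deriv]
        exact hinv _ _ (hneg x hx) (by linarith [hx.1]) (hLa x hx)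
    intro y
    set N := L * (|y| + 1) with hN
    have hNpos : 0 < N := by positivity
    have he : Real.exp (-N) < 1 := by simpa using hNpos
    have he0 := Real.exp_pos (-N)
    have hbm : 0 < m - a := by linarith [hm.1]
    have hmx : a + (m - a) * Real.exp (-N) ≤ m := by nlinarith
    have hx : a + (m - a) * Real.exp (-N) ∈ Ioo a b :=
      ⟨by nlinarith, by linarith [hm.2]⟩
    refine ⟨_, hx, ?_⟩
    have h := hanti hx hm hmx
    simp only [hGm, add_sub_cancel_left] at h
    rw [Real.log_mul hbm.ne' he0.ne', Real.log_exp] at h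
    have h2 : L⁻¹ * N = |y| + 1 := by rw [hN]; field_simp
    have h3 : L⁻¹ * (Real.log (m - a) + -N) = L⁻¹ * Real.log (m - a) - (|y| + 1) := by
      rw [← h2]; ring
    rw [h3] at h
    linarith [le_abs_self y]

open Set Filter Topology in
theorem vsp_unique (g : ℝ → ℝ) (hg : ContDiff ℝ 1 g) (p q : ℝ → ℝ)
    (hp : ∀ t, HasDerivAt p (g (p t)) t) (hq : ∀ t, HasDerivAt q (g (q t)) t)
    (t₀ : ℝ) (h0 : p t₀ = q t₀) : ∀ t, p t = q t := by
  have hpc : Continuous p := continuous_iff_continuousAt.2 fun t => (hp t).continuousAt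
  have hqc : Continuous q := continuous_iff_continuousAt.2 fun t => (hq t).continuousAt
  have hcl : IsClopen {t | p t = q t} := by
    refine ⟨isClosed_eq hpc hqc, isOpen_iff_mem_nhds.2 fun t ht => ?_⟩
    obtain ⟨K, S, hS, hl⟩ := (hg.contDiffAt (x := p t)).exists_lipschitzOnWith
    have hS' : S ∈ 𝓝 (q t) := by rw [← (show p t = q t from ht)]; exact hS
    exact ODE_solution_unique_of_eventually (v := fun _ => g) (s := fun _ => S) (K := K)
      (Eventually.of_forall fun _ => hl)
      ((hpc.continuousAt.eventually_mem hS).mono fun x hx => ⟨hp x, hx⟩)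
      ((hqc.continuousAt.eventually_mem hS').mono fun x hx => ⟨hq x, hx⟩) ht
  have := hcl.eq_univ ⟨t₀, h0⟩
  intro t
  exact (this ▸ mem_univ t : t ∈ {t | p t = q t})

/-- Viscous shock profile: existence and uniqueness up to translation (Lemma 2.2, existence part). -/
theorem viscous_shock_profile_existence
    (f f₀ : ℝ → ℝ) (up um s : ℝ)
    (hf : ContDiff ℝ 1 f)
    (hlt : up < um)
    (hs : s = (f up - f um) / (up - um))
    (hf₀ : ∀ φ : ℝ, f₀ φ = -s * (φ - um) + f φ - f um)
    (hOleinik : ∀ φ ∈ Set.Ioo up um, f₀ φ < 0) :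
    ∃ φ : ℝ → ℝ,
      ContDiff ℝ 1 φ ∧
      (∀ ξ : ℝ, deriv φ ξ = f₀ (φ ξ)) ∧
      (∀ ξ : ℝ, up < φ ξ ∧ φ ξ < um) ∧
      StrictAnti φ ∧
      Filter.Tendsto φ Filter.atBot (nhds um) ∧
      Filter.Tendsto φ Filter.atTop (nhds up) ∧
      (∀ ψ : ℝ → ℝ, ContDiff ℝ 1 ψ →
        (∀ ξ : ℝ, deriv ψ ξ = f₀ (ψ ξ)) →
        Filter.Tendsto ψ Filter.atBot (nhds um) →
        Filter.Tendsto ψ Filter.atTop (nhds up) →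
        ∃ c : ℝ, ∀ ξ : ℝ, ψ ξ = φ (ξ - c)) := by
  have hne : up - um ≠ 0 := by linarith
  have hg : ContDiff ℝ 1 f₀ := by
    rw [show f₀ = fun x => -s * (x - um) + f x - f um from funext hf₀]
    fun_prop
  have hum : f₀ um = 0 := by rw [hf₀]; ring
  have hup : f₀ up = 0 := by rw [hf₀, hs]; field_simp; ring
  obtain ⟨G, hG, hlow, hhigh⟩ := vsp_G f₀ up um hlt hg hup hum hOleinik
  have hGc : ContinuousOn G (Set.Ioo up um) :=
    fun x hx => (hG x hx).continuousAt.continuousWithinAt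
  have hGanti : StrictAntiOn G (Set.Ioo up um) := by
    apply strictAntiOn_of_deriv_neg (convex_Ioo up um) hGc
    rw [interior_Ioo]
    intro x hx
    rw [(hG x hx).deriv]
    exact inv_lt_zero.2 (hOleinik x hx)
  have hsurj : ∀ y : ℝ, ∃ x ∈ Set.Ioo up um, G x = y := by
    intro y
    obtain ⟨x₁, hx₁, h₁⟩ := hlow y
    obtain ⟨x₂, hx₂, h₂⟩ := hhigh y
    exact isPreconnected_Ioo.intermediate_value hx₁ hx₂ hGc ⟨h₁.le, h₂.le⟩
  choose φ hφ hGφ using hsurj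
  have hlt1 : ∀ a ∈ Set.Ioo up um, ∀ ξ, a < φ ξ ↔ ξ < G a := by
    intro a ha ξ
    rw [← hGanti.lt_iff_gt (hφ ξ) ha, hGφ]
  have hlt2 : ∀ a ∈ Set.Ioo up um, ∀ ξ, φ ξ < a ↔ G a < ξ := by
    intro a ha ξ
    rw [← hGanti.lt_iff_gt ha (hφ ξ), hGφ]
  have hcont : Continuous φ := by
    refine continuous_iff_continuousAt.2 fun ξ => tendsto_order.2 ⟨fun a ha => ?_, fun a ha => ?_⟩
    · by_cases h : up < a
      · have ha' : a ∈ Set.Ioo up um := ⟨h, ha.trans (hφ ξ).2⟩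
        filter_upwards [Iio_mem_nhds ((hlt1 a ha' ξ).1 ha)] with x hx
        exact (hlt1 a ha' x).2 hx
      · exact Filter.Eventually.of_forall fun x => (not_lt.1 h).trans_lt (hφ x).1
    · by_cases h : a < um
      · have ha' : a ∈ Set.Ioo up um := ⟨(hφ ξ).1.trans ha, h⟩
        filter_upwards [Ioi_mem_nhds ((hlt2 a ha' ξ).1 ha)] with x hx
        exact (hlt2 a ha' x).2 hx
      · exact Filter.Eventually.of_forall fun x => (hφ x).2.trans_le (not_lt.1 h)
  have hderiv : ∀ ξ, HasDerivAt φ (f₀ (φ ξ)) ξ := by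
    intro ξ
    have := HasDerivAt.of_local_left_inverse hcont.continuousAt (hG _ (hφ ξ))
      (inv_ne_zero (hOleinik _ (hφ ξ)).ne) (Filter.Eventually.of_forall hGφ)
    simpa using this
  refine ⟨φ, ?_, fun ξ => (hderiv ξ).deriv, fun ξ => hφ ξ, ?_, ?_, ?_, ?_⟩
  · rw [contDiff_one_iff_deriv]
    refine ⟨fun ξ => (hderiv ξ).differentiableAt, ?_⟩
    rw [show deriv φ = fun ξ => f₀ (φ ξ) from funext fun ξ => (hderiv ξ).deriv]
    exact hg.continuous.comp hcont
  · intro x y hxy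
    rw [hlt1 _ (hφ y), hGφ]
    exact hxy
  · refine tendsto_order.2 ⟨fun a ha => ?_, fun a ha => ?_⟩
    · by_cases h : up < a
      · filter_upwards [Filter.Iio_mem_atBot (G a)] with x hx
        exact (hlt1 a ⟨h, ha⟩ x).2 hx
      · exact Filter.Eventually.of_forall fun x => (not_lt.1 h).trans_lt (hφ x).1
    · exact Filter.Eventually.of_forall fun x => (hφ x).2.trans ha
  · refine tendsto_order.2 ⟨fun a ha => ?_, fun a ha => ?_⟩
    · exact Filter.Eventually.of_forall fun x => ha.trans (hφ x).1
    · by_cases h : a < um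
      · filter_upwards [Filter.Ioi_mem_atTop (G a)] with x hx
        exact (hlt2 a ⟨ha, h⟩ x).2 hx
      · exact Filter.Eventually.of_forall fun x => (hφ x).2.trans_le (not_lt.1 h)
  · intro ψ hψ hψd hbot htop
    obtain ⟨x₁, h₁⟩ := (hbot.eventually (lt_mem_nhds (hφ 0).2)).exists
    obtain ⟨x₂, h₂⟩ := (htop.eventually (gt_mem_nhds (hφ 0).1)).exists
    obtain ⟨c, hc⟩ := mem_range_of_exists_le_of_exists_ge hψ.continuous ⟨x₂, h₂.le⟩ ⟨x₁, h₁.le⟩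
    refine ⟨c, vsp_unique f₀ hg ψ (fun ξ => φ (ξ - c)) (fun t => ?_) (fun t => ?_) c (by simpa using hc)⟩
    · rw [← hψd]
      exact (hψ.differentiable (by decide) t).hasDerivAt
    · exact (hderiv (t - c)).comp_sub_const t c
end

section
/- (Bounds on the weight function, properties (prop-weight)) Define w(φ) := (φ - u₋)(φ - u₊) / f₀(φ) for φ ∈ (u₊, u₋). Then there exist constants c > 0 and C > 0 such that c ≤ w(φ) ≤ C for all φ ∈ (u₊, u₋); moreover w is differentiable on (u₊, u₋) and |w'(φ)| ≤ C for all φ ∈ (u₊, u₋). -/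
lemma aux_bounds (g g' g'' : ℝ → ℝ) (a b M x v : ℝ)
    (h1 : ∀ t, HasDerivAt g (g' t) t) (h2 : ∀ t, HasDerivAt g' (g'' t) t)
    (b1 : ∀ t ∈ Set.Icc a b, |g' t| ≤ M) (b2 : ∀ t ∈ Set.Icc a b, |g'' t| ≤ M)
    (hx : x ∈ Set.Icc a b) (hv : v ∈ Set.Icc a b) (hgx : g x = 0) :
    |g v| ≤ M * |v - x| ∧ |g v - (v - x) * g' v| ≤ M * |v - x| ^ 2 := by
  constructor
  · have := (convex_Icc a b).norm_image_sub_le_of_norm_hasDerivWithin_le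
      (f := g) (f' := g') (C := M) (fun t _ => (h1 t).hasDerivWithinAt) b1 hx hv
    simpa [hgx] using this
  · have hsub : Set.uIcc x v ⊆ Set.Icc a b := Set.uIcc_subset_Icc hx hv
    have := (convex_uIcc x v).norm_image_sub_le_of_norm_hasDerivWithin_le
      (f := fun t => g t - (t - x) * g' t) (f' := fun t => g' t - (1 * g' t + (t - x) * g'' t))
      (C := |v - x| * M)
      (fun t _ => ((h1 t).sub (((hasDerivAt_id t).sub_const x).mul (h2 t))).hasDerivWithinAt)
      (fun t ht => by
        have e : g' t - (1 * g' t + (t - x) * g'' t) = -((t - x) * g'' t) := by ring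
        rw [e, norm_neg, norm_mul]
        exact mul_le_mul (Set.abs_sub_left_of_mem_uIcc ht) (b2 t (hsub ht)) (abs_nonneg _)
          (abs_nonneg _))
      Set.left_mem_uIcc Set.right_mem_uIcc
    simp only [hgx, sub_self, zero_mul, sub_zero, Real.norm_eq_abs] at this
    calc _ ≤ _ := this
      _ = _ := by ring

/-- Bounds on the weight function `w(φ) = (φ - um)(φ - up)/f₀(φ)` (properties (prop-weight)). -/
theorem weight_function_bounds
    (f f₀ w : ℝ → ℝ) (up um s : ℝ)
    (hf : ContDiff ℝ 2 f)
    (hlt : up < um)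
    (hs : s = (f up - f um) / (up - um))
    (hf₀ : ∀ v : ℝ, f₀ v = -s * (v - um) + f v - f um)
    (hOleinik : ∀ v ∈ Set.Ioo up um, f₀ v < 0)
    (hLaxp : deriv f up < s) (hLaxm : s < deriv f um)
    (hw : ∀ v ∈ Set.Ioo up um, w v = (v - um) * (v - up) / f₀ v) :
    ∃ c > (0:ℝ), ∃ C > (0:ℝ),
      (∀ v ∈ Set.Ioo up um, c ≤ w v ∧ w v ≤ C) ∧
      (∀ v ∈ Set.Ioo up um, DifferentiableAt ℝ w v ∧ |deriv w v| ≤ C) := by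
  have hL : 0 < um - up := sub_pos.2 hlt
  have hfd : ∀ t, HasDerivAt f (deriv f t) t := fun t =>
    (hf.differentiable (by norm_num) t).hasDerivAt
  have hf1 : ContDiff ℝ 1 (deriv f) := by
    have : ContDiff ℝ (1 + 1) f := by simpa [one_add_one_eq_two] using hf
    exact (contDiff_succ_iff_deriv.1 this).2.2
  have hfd2 : ∀ t, HasDerivAt (deriv f) (deriv (deriv f) t) t := fun t =>
    (hf1.differentiable (by norm_num) t).hasDerivAt
  have hf2c : Continuous (deriv (deriv f)) := hf1.continuous_deriv (by norm_num)
  have hg1 : ∀ t, HasDerivAt f₀ (deriv f t - s) t := by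
    intro t
    have e : f₀ = fun v => -s * (v - um) + f v - f um := funext hf₀
    rw [e]
    have := ((((hasDerivAt_id t).sub_const um).const_mul (-s)).add (hfd t)).sub_const (f um)
    have e2 : deriv f t - s = -s * 1 + deriv f t := by ring
    rw [e2]
    exact this
  have hg2 : ∀ t, HasDerivAt (fun t => deriv f t - s) (deriv (deriv f) t) t := fun t =>
    (hfd2 t).sub_const s
  have gum : f₀ um = 0 := by rw [hf₀]; ring
  have gup : f₀ up = 0 := by
    rw [hf₀, hs]
    have : up - um ≠ 0 := by linarith
    field_simp
    ring
  obtain ⟨M1, hM1⟩ := (isCompact_Icc (a := up) (b := um)).exists_bound_of_continuousOn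
    (f := fun t => deriv f t - s) (hf1.continuous.sub continuous_const).continuousOn
  obtain ⟨M2, hM2⟩ := (isCompact_Icc (a := up) (b := um)).exists_bound_of_continuousOn
    (f := deriv (deriv f)) hf2c.continuousOn
  obtain ⟨M, hMpos, hMa, hMb⟩ : ∃ M > (0:ℝ), M1 ≤ M ∧ M2 ≤ M :=
    ⟨max 1 (max M1 M2), by positivity, by simp, by simp⟩
  have key := fun x v => aux_bounds f₀ _ _ up um M x v hg1 hg2
    (fun t ht => (hM1 t ht).trans hMa) (fun t ht => (hM2 t ht).trans hMb)
  -- the quotient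
  have hd : Differentiable ℝ f₀ := fun t => (hg1 t).differentiableAt
  set h := dslope f₀ up with hh
  have hhc : Continuous h := by
    rw [continuous_iff_continuousAt]
    intro t
    by_cases ht : t = up
    · rw [ht]; exact continuousAt_dslope_same.2 (hd up)
    · exact (continuousAt_dslope_of_ne ht).2 (hd t).continuousAt
  have hhe : ∀ t, (t - up) * h t = f₀ t := by
    intro t
    have := sub_smul_dslope f₀ up t
    simpa [gup] using this
  have hhum : h um = 0 := by
    have := hhe um
    rw [gum] at this
    rcases mul_eq_zero.1 this with h0 | h0
    · linarith
    · exact h0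
  have hhd : DifferentiableAt ℝ h um := (differentiableAt_dslope_of_ne hlt.ne').2 (hd um)
  set k := dslope h um with hk
  have hkc : Continuous k := by
    rw [continuous_iff_continuousAt]
    intro t
    by_cases ht : t = um
    · rw [ht]; exact continuousAt_dslope_same.2 hhd
    · exact (continuousAt_dslope_of_ne ht).2 hhc.continuousAt
  have hke : ∀ t, (t - um) * k t = h t := by
    intro t
    have := sub_smul_dslope h um t
    simpa [hhum] using this
  have hgk : ∀ t, f₀ t = (t - up) * ((t - um) * k t) := fun t => by rw [hke, hhe]
  have hkpos : ∀ t ∈ Set.Icc up um, 0 < k t := by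
    rintro t ⟨h1, h2⟩
    rcases h1.eq_or_lt with rfl | h1
    · have e1 : h up = deriv f up - s := by
        rw [hh, dslope_same]; exact (hg1 up).deriv
      have := hke up
      rw [e1] at this
      nlinarith
    rcases h2.eq_or_lt with rfl | h2
    · have e1 : k t = deriv h t := by rw [hk, dslope_same]
      have e2 : HasDerivAt (fun v => (v - up) * h v) (1 * h t + (t - up) * deriv h t) t :=
        ((hasDerivAt_id t).sub_const up).mul hhd.hasDerivAt
      have e3 : (fun v => (v - up) * h v) = f₀ := funext hhe
      rw [e3] at e2
      have := e2.unique (hg1 t)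
      rw [hhum, ← e1] at this
      by_contra hc
      nlinarith
    · have := hOleinik t ⟨h1, h2⟩
      rw [hgk] at this
      by_contra hc
      have : 0 < (t - up) * (um - t) := mul_pos (by linarith) (by linarith)
      nlinarith
  obtain ⟨x0, hx0, hmin⟩ := (isCompact_Icc (a := up) (b := um)).exists_isMinOn
    ⟨up, Set.left_mem_Icc.2 hlt.le⟩ hkc.continuousOn
  obtain ⟨x1, hx1, hmax⟩ := (isCompact_Icc (a := up) (b := um)).exists_isMaxOn
    ⟨up, Set.left_mem_Icc.2 hlt.le⟩ hkc.continuousOn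
  have p0 := hkpos x0 hx0
  have p1 := hkpos x1 hx1
  have hwk : ∀ v ∈ Set.Ioo up um, w v = (k v)⁻¹ := by
    intro v hv
    have := hkpos v ⟨hv.1.le, hv.2.le⟩
    have a1 : v - up ≠ 0 := by linarith [hv.1]
    have a2 : v - um ≠ 0 := by linarith [hv.2]
    rw [hw v hv, hgk]
    field_simp
  -- bound on the numerator
  set L := um - up with hLdef
  have hN : ∀ v ∈ Set.Ioo up um,
      |((v - um) + (v - up)) * f₀ v - (v - um) * (v - up) * (deriv f v - s)|
        ≤ ((L * M + M) * (4 / L ^ 2)) * ((v - um) * (v - up)) ^ 2 := by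
    intro v hv
    have hv' : v ∈ Set.Icc up um := ⟨hv.1.le, hv.2.le⟩
    obtain ⟨A1, A2⟩ := key up v (Set.left_mem_Icc.2 hlt.le) hv' gup
    obtain ⟨B1, B2⟩ := key um v (Set.right_mem_Icc.2 hlt.le) hv' gum
    have la : |v - up| ≤ L := by rw [abs_of_pos (by linarith [hv.1])]; linarith [hv.2]
    have lb : |v - um| ≤ L := by rw [abs_of_neg (by linarith [hv.2])]; linarith [hv.1]
    have NA : |((v - um) + (v - up)) * f₀ v - (v - um) * (v - up) * (deriv f v - s)|
        ≤ (L * M + M) * (v - up) ^ 2 := by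
      rw [← sq_abs (v - up)]
      calc _ = |(v - um) * (f₀ v - (v - up) * (deriv f v - s)) + (v - up) * f₀ v| := by
            congr 1; ring
        _ ≤ |v - um| * |f₀ v - (v - up) * (deriv f v - s)| + |v - up| * |f₀ v| := by
            rw [← abs_mul, ← abs_mul]; exact abs_add_le _ _
        _ ≤ L * (M * |v - up| ^ 2) + |v - up| * (M * |v - up|) := by gcongr
        _ = _ := by ring
    have NB : |((v - um) + (v - up)) * f₀ v - (v - um) * (v - up) * (deriv f v - s)|
        ≤ (L * M + M) * (v - um) ^ 2 := by
      rw [← sq_abs (v - um)]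
      calc _ = |(v - up) * (f₀ v - (v - um) * (deriv f v - s)) + (v - um) * f₀ v| := by
            congr 1; ring
        _ ≤ |v - up| * |f₀ v - (v - um) * (deriv f v - s)| + |v - um| * |f₀ v| := by
            rw [← abs_mul, ← abs_mul]; exact abs_add_le _ _
        _ ≤ L * (M * |v - um| ^ 2) + |v - um| * (M * |v - um|) := by gcongr
        _ = _ := by ring
    rcases le_total (L / 2) (v - up) with hc | hc
    · have q : 1 ≤ 4 / L ^ 2 * (v - up) ^ 2 := by
        rw [div_mul_eq_mul_div, one_le_div (by positivity)]; nlinarith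
      calc _ ≤ _ := NB
        _ ≤ (L * M + M) * (v - um) ^ 2 * (4 / L ^ 2 * (v - up) ^ 2) :=
            le_mul_of_one_le_right (by positivity) q
        _ = _ := by ring
    · have hc' : L / 2 ≤ um - v := by linarith
      have q : 1 ≤ 4 / L ^ 2 * (v - um) ^ 2 := by
        rw [div_mul_eq_mul_div, one_le_div (by positivity)]; nlinarith
      calc _ ≤ _ := NA
        _ ≤ (L * M + M) * (v - up) ^ 2 * (4 / L ^ 2 * (v - um) ^ 2) :=
            le_mul_of_one_le_right (by positivity) q
        _ = _ := by ring
  set K := (L * M + M) * (4 / L ^ 2) with hK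
  have hKpos : 0 < K := by positivity
  refine ⟨(k x1)⁻¹, by positivity, (k x0)⁻¹ + K / (k x0) ^ 2, by positivity, ?_, ?_⟩
  · intro v hv
    have hv' : v ∈ Set.Icc up um := ⟨hv.1.le, hv.2.le⟩
    have m0 : k x0 ≤ k v := hmin hv'
    have m1 : k v ≤ k x1 := hmax hv'
    have := hkpos v hv'
    rw [hwk v hv]
    refine ⟨inv_anti₀ this m1, (inv_anti₀ p0 m0).trans ?_⟩
    have : 0 < K / (k x0) ^ 2 := by positivity
    linarith
  · intro v hv
    have hv' : v ∈ Set.Icc up um := ⟨hv.1.le, hv.2.le⟩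
    have m0 : k x0 ≤ k v := hmin hv'
    have hgv := hOleinik v hv
    have D := ((((hasDerivAt_id v).sub_const um).mul ((hasDerivAt_id v).sub_const up)).div
      (hg1 v) hgv.ne)
    have Dw := D.congr_of_eventuallyEq (f₁ := w)
      (Filter.eventuallyEq_of_mem (isOpen_Ioo.mem_nhds hv) (fun t ht => hw t ht))
    refine ⟨Dw.differentiableAt, ?_⟩
    rw [Dw.deriv]
    have hP : 0 < ((v - um) * (v - up)) ^ 2 := by
      have a1 : v - up ≠ 0 := by linarith [hv.1]
      have a2 : v - um ≠ 0 := by linarith [hv.2]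
      positivity
    have hn := hN v hv
    have e : f₀ v ^ 2 = ((v - um) * (v - up)) ^ 2 * (k v) ^ 2 := by rw [hgk]; ring
    have hkv := hkpos v hv'
    have : |((v - um) + (v - up)) * f₀ v - (v - um) * (v - up) * (deriv f v - s)| / f₀ v ^ 2
        ≤ K / (k x0) ^ 2 := by
      rw [e, div_le_div_iff₀ (by positivity) (by positivity)]
      have q : (k x0) ^ 2 ≤ (k v) ^ 2 := by gcongr
      calc _ ≤ (K * ((v - um) * (v - up)) ^ 2) * (k v) ^ 2 := by
            apply mul_le_mul (by linarith) q (by positivity) (by positivity)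
        _ = _ := by ring
    have h0 : 0 < (k x0)⁻¹ := by positivity
    rw [abs_div, abs_of_nonneg (sq_nonneg (f₀ v))]
    simp only [id, Pi.mul_apply] at *
    have e2 : (1 * (v - up) + (v - um) * 1) * f₀ v - (v - um) * (v - up) * (deriv f v - s)
       = ((v - um) + (v - up)) * f₀ v - (v - um) * (v - up) * (deriv f v - s) := by ring
    rw [e2]
    linarith
end
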